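/- (Scalar Nevanlinna representation with finite mass.) Let f : ℂ → ℂ be holomorphic on the upper half plane Π = {z ∈ ℂ : Im z > 0} and satisfy Im f(z) ≥ 0 for all z ∈ Π. Suppose liminf_{s → +∞} |i·s · f(i·s)| < ∞ (liminf over real s tending to +∞). Then there exists a finite Borel measure μ on ℝ such that f(z) = ∫_ℝ (t - z)⁻¹ dμ(t) for all z ∈ Π. -/

import Mathlib

open MeasureTheory Filter

open Complex Metric Topology InnerProductSpace

theorem poissonKernel_circleMap_nonneg {w : ℂ} (hw : ‖w‖ < 1) (θ : ℝ) :
    0 ≤ poissonKernel 0 w (circleMap 0 1 θ) := by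
  have : 0 ≤ 1 - ‖w‖ ^ 2 := by nlinarith [norm_nonneg w]
  simp only [poissonKernel, sub_zero, norm_circleMap_zero, abs_one, one_pow]
  positivity

theorem norm_poissonKernel_circleMap_le {w : ℂ} (hw : ‖w‖ < 1) (θ : ℝ) :
    ‖poissonKernel 0 w (circleMap 0 1 θ)‖ ≤ 1 / (1 - ‖w‖) ^ 2 := by
  have h1 : 1 - ‖w‖ ≤ ‖circleMap 0 1 θ - w‖ := by
    simpa using norm_sub_norm_le (circleMap 0 1 θ) w
  have h2 : 0 < 1 - ‖w‖ := by linarith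
  rw [Real.norm_of_nonneg (poissonKernel_circleMap_nonneg hw θ)]
  simp only [poissonKernel, sub_zero, norm_circleMap_zero, abs_one]
  gcongr
  nlinarith [norm_nonneg w]

theorem continuous_poissonKernel_circleMap {w : ℂ} (hw : ‖w‖ < 1) :
    Continuous fun θ ↦ poissonKernel 0 w (circleMap 0 1 θ) := by
  unfold poissonKernel
  refine Continuous.div (by fun_prop) (by fun_prop) fun θ h ↦ ?_
  have : circleMap 0 1 θ = w := by simpa [sub_eq_zero] using h
  simp [← this] at hw

/-- A positive harmonic function on the unit disc is the Poisson integral of a finite measure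
(on angles). -/
theorem exists_finiteMeasure_eq_integral_poissonKernel {u : ℂ → ℝ}
    (hu : HarmonicOnNhd u (ball 0 1)) (hpos : ∀ w ∈ ball (0 : ℂ) 1, 0 ≤ u w) :
    ∃ σ : Measure ℝ, IsFiniteMeasure σ ∧
      ∀ w ∈ ball (0 : ℂ) 1, u w = ∫ θ, poissonKernel 0 w (circleMap 0 1 θ) ∂σ := by
  have hcont : ContinuousOn u (ball 0 1) := fun x hx ↦ (hu x hx).1.continuousAt.continuousWithinAt
  have hmem {r : ℝ} (hr : r ∈ Set.Ioo (0 : ℝ) 1) (θ : ℝ) : circleMap 0 r θ ∈ ball (0 : ℂ) 1 := by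
    simpa [abs_of_pos hr.1] using hr.2
  have hcirc {r : ℝ} (hr : r ∈ Set.Ioo (0 : ℝ) 1) : Continuous fun θ ↦ u (circleMap 0 r θ) :=
    hcont.comp_continuous (continuous_circleMap 0 r) (hmem hr)
  have hpoisson {r : ℝ} (hr : r ∈ Set.Ioo (0 : ℝ) 1) {w : ℂ} (hw : w ∈ ball (0 : ℂ) 1) :
      u (r * w) = ∫ θ in (0)..(2 * Real.pi),
        (2 * Real.pi)⁻¹ * u (circleMap 0 r θ) * poissonKernel 0 w (circleMap 0 1 θ) := by
    have hrw : (r : ℂ) * w ∈ ball (0 : ℂ) r := by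
      have : ‖w‖ < 1 := by simpa using hw
      simpa [abs_of_pos hr.1] using mul_lt_of_lt_one_right hr.1 this
    rw [← (hu.mono (closedBall_subset_ball hr.2)).circleAverage_poissonKernel_smul hrw,
      Real.circleAverage_def, smul_eq_mul, ← intervalIntegral.integral_const_mul]
    refine intervalIntegral.integral_congr fun θ _ ↦ ?_
    have hker : poissonKernel 0 (r * w) (circleMap 0 r θ)
        = poissonKernel 0 w (circleMap 0 1 θ) := by
      have h0 : circleMap 0 r θ = r * circleMap 0 1 θ := by simp [circleMap]
      have hr0 : r ≠ 0 := hr.1.ne'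
      simp only [poissonKernel, sub_zero, h0, ← mul_sub, norm_mul, mul_pow]
      rw [mul_div_mul_left]
      simpa using hr0
    simp only [Pi.smul_apply', smul_eq_mul, hker]
    ring
  let dens (r : ℝ) (θ : ℝ) : ℝ := (2 * Real.pi)⁻¹ * u (circleMap 0 r θ)
  have hdens {r : ℝ} (hr : r ∈ Set.Ioo (0 : ℝ) 1) : Continuous (dens r) := (hcirc hr).const_mul _
  have hdens0 {r : ℝ} (hr : r ∈ Set.Ioo (0 : ℝ) 1) (θ : ℝ) : 0 ≤ dens r θ :=
    mul_nonneg (by positivity) (hpos _ (hmem hr θ))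
  let ν (r : ℝ) : Measure ℝ := (volume.restrict (Set.Ioc 0 (2 * Real.pi))).withDensity
    fun θ ↦ ENNReal.ofReal (dens r θ)
  have hpi : (0 : ℝ) ≤ 2 * Real.pi := by positivity
  have hνint {r : ℝ} (hr : r ∈ Set.Ioo (0 : ℝ) 1) {w : ℂ} (hw : w ∈ ball (0 : ℂ) 1) :
      ∫ θ, poissonKernel 0 w (circleMap 0 1 θ) ∂(ν r) = u (r * w) := by
    rw [hpoisson hr hw, intervalIntegral.integral_of_le hpi,
      integral_withDensity_eq_integral_toReal_smul (hdens hr).measurable.ennreal_ofReal (by simp)]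
    refine integral_congr_ae (.of_forall fun θ ↦ ?_)
    simp only [ENNReal.toReal_ofReal (hdens0 hr θ), smul_eq_mul, dens]
  have hνmass {r : ℝ} (hr : r ∈ Set.Ioo (0 : ℝ) 1) : ν r Set.univ = ENNReal.ofReal (u 0) := by
    have h0 := hpoisson hr (mem_ball_self one_pos)
    simp only [mul_zero] at h0
    rw [h0, withDensity_apply _ .univ, Measure.restrict_univ,
      ← ofReal_integral_eq_lintegral_ofReal _ (.of_forall (hdens0 hr)),
      intervalIntegral.integral_of_le hpi]
    · simp [dens, poissonKernel]
    · exact ((hdens hr).integrableOn_Icc (a := 0) (b := 2 * Real.pi)).mono_set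
        Set.Ioc_subset_Icc_self
  have hex (r : ℝ) : ∃ ρ : FiniteMeasure ℝ, r ∈ Set.Ioo (0 : ℝ) 1 → (ρ : Measure ℝ) = ν r := by
    by_cases hr : r ∈ Set.Ioo (0 : ℝ) 1
    · exact ⟨⟨ν r, ⟨by simp [hνmass hr]⟩⟩, fun _ ↦ rfl⟩
    · exact ⟨0, fun h ↦ absurd h hr⟩
  choose ρ hρ using hex
  have hcompact := isCompact_setOfPred_finiteMeasure_le_of_isCompact (E := ℝ) (u 0).toNNReal
    (isCompact_Icc (a := (0 : ℝ)) (b := 2 * Real.pi))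
  have hIoo : Set.Ioo (0 : ℝ) 1 ∈ 𝓝[<] (1 : ℝ) := Ioo_mem_nhdsLT one_pos
  let 𝒰 : Ultrafilter ℝ := Ultrafilter.of (𝓝[<] (1 : ℝ))
  have h𝒰 : (𝒰 : Filter ℝ) ≤ 𝓝[<] (1 : ℝ) := Ultrafilter.of_le _
  obtain ⟨σ, -, hσ⟩ := hcompact.ultrafilter_le_nhds (𝒰.map ρ) (by
    rw [le_principal_iff, Ultrafilter.mem_coe, Ultrafilter.mem_map]
    refine h𝒰 (mem_of_superset hIoo fun r hr ↦ ⟨?_, ?_⟩)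
    · rw [← ENNReal.coe_le_coe, FiniteMeasure.ennreal_mass, hρ r hr, hνmass hr]
      rfl
    · rw [FiniteMeasure.null_iff_toMeasure_null, hρ r hr]
      apply withDensity_absolutelyContinuous
      rw [Measure.restrict_apply measurableSet_Icc.compl, show
        (Set.Icc 0 (2 * Real.pi))ᶜ ∩ Set.Ioc 0 (2 * Real.pi) = ∅ by grind]
      simp)
  refine ⟨σ, inferInstance, fun w hw ↦ ?_⟩
  have hw' : ‖w‖ < 1 := by simpa using hw
  let k : BoundedContinuousFunction ℝ ℝ := .ofNormedAddCommGroup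
    (fun θ ↦ poissonKernel 0 w (circleMap 0 1 θ)) (continuous_poissonKernel_circleMap hw')
    (1 / (1 - ‖w‖) ^ 2) (norm_poissonKernel_circleMap_le hw')
  have hlim₁ : Tendsto (fun r ↦ ∫ θ, k θ ∂(ρ r : Measure ℝ)) 𝒰 (𝓝 (∫ θ, k θ ∂(σ : Measure ℝ))) :=
    FiniteMeasure.tendsto_iff_forall_integral_tendsto.1 (show Tendsto ρ 𝒰 (𝓝 σ) from hσ) k
  have hlim₂ : Tendsto (fun r : ℝ ↦ u (r * w)) (𝓝[<] 1) (𝓝 (u w)) := by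
    have h1 : ContinuousAt u ((1 : ℝ) * w) := by
      simpa using hcont.continuousAt (isOpen_ball.mem_nhds hw)
    have h2 : ContinuousAt (fun r : ℝ ↦ u (r * w)) 1 :=
      ContinuousAt.comp (f := fun r : ℝ ↦ (r : ℂ) * w) h1 (by fun_prop)
    simpa using h2.tendsto.mono_left nhdsWithin_le_nhds
  refine tendsto_nhds_unique ((hlim₂.mono_left h𝒰).congr' ?_) hlim₁
  filter_upwards [h𝒰 hIoo] with r hr
  rw [hρ r hr]
  exact (hνint hr hw).symm

/-- The Cayley transform of the unit disc onto the upper half plane, also used on the circle. -/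
noncomputable def discToHalfPlane (w : ℂ) : ℂ := I * ((1 + w) / (1 - w))

theorem im_discToHalfPlane (w : ℂ) :
    (discToHalfPlane w).im = (1 - ‖w‖ ^ 2) / ‖1 - w‖ ^ 2 := by
  have h := congrFun (poissonKernel_eq_re_herglotzRieszKernel (c := 0) (w := w)) 1
  simp only [poissonKernel, herglotzRieszKernel, Function.comp_apply, sub_zero, norm_one,
    one_pow] at h
  simp [discToHalfPlane, h]

theorem im_discToHalfPlane_pos {w : ℂ} (hw : ‖w‖ < 1) : 0 < (discToHalfPlane w).im := by
  have h : 1 - w ≠ 0 := fun h ↦ by simp [← sub_eq_zero.1 h] at hw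
  rw [im_discToHalfPlane]
  have : 0 < 1 - ‖w‖ ^ 2 := by nlinarith [norm_nonneg w]
  positivity

theorem exists_discToHalfPlane_eq {z : ℂ} (hz : 0 < z.im) :
    ∃ w : ℂ, ‖w‖ < 1 ∧ discToHalfPlane w = z := by
  have hz' : z + I ≠ 0 := fun h ↦ by
    have := congrArg im h
    simp at this
    linarith
  have h1 : 1 - (z - I) / (z + I) = 2 * I / (z + I) := by field_simp; ring
  have h2 : 1 + (z - I) / (z + I) = 2 * z / (z + I) := by field_simp; ring
  have heq : discToHalfPlane ((z - I) / (z + I)) = z := by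
    rw [discToHalfPlane, h1, h2]
    field_simp
  refine ⟨_, ?_, heq⟩
  have h3 := im_discToHalfPlane ((z - I) / (z + I))
  rw [heq] at h3
  have h4 : 0 < 1 - ‖(z - I) / (z + I)‖ ^ 2 := by
    by_contra! hc
    have := div_nonpos_of_nonpos_of_nonneg hc (sq_nonneg ‖1 - (z - I) / (z + I)‖)
    linarith
  nlinarith [norm_nonneg ((z - I) / (z + I))]

/-- The Poisson kernel of the disc in terms of the Cauchy kernel of the half plane. -/
theorem mul_im_inv_sub_discToHalfPlane {w ζ : ℂ} (hw : ‖w‖ < 1) (hζ : ‖ζ‖ = 1) (hζ1 : ζ ≠ 1) :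
    4 * (‖1 - ζ‖ ^ 2)⁻¹ * ((((discToHalfPlane ζ).re : ℂ) - discToHalfPlane w)⁻¹).im
      = poissonKernel 0 w ζ := by
  have hw1 : 1 - w ≠ 0 := fun h ↦ by simp [← sub_eq_zero.1 h] at hw
  have hζ1' : 1 - ζ ≠ 0 := sub_ne_zero.2 hζ1.symm
  have hζw : ζ - w ≠ 0 := fun h ↦ by
    rw [sub_eq_zero.1 h] at hζ
    exact hw.ne hζ
  have hre : ((discToHalfPlane ζ).re : ℂ) = discToHalfPlane ζ :=
    Complex.ext (by simp) (by simp [im_discToHalfPlane, hζ])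
  have hsub : discToHalfPlane ζ - discToHalfPlane w
      = 2 * I * (ζ - w) / ((1 - ζ) * (1 - w)) := by
    unfold discToHalfPlane
    field_simp
    ring
  have him : (discToHalfPlane ζ - discToHalfPlane w).im = -(discToHalfPlane w).im := by
    simp [im_discToHalfPlane ζ, hζ]
  rw [hre, inv_im, him, im_discToHalfPlane, normSq_eq_norm_sq, hsub]
  simp only [poissonKernel, sub_zero, hζ, norm_div, norm_mul, norm_I, mul_one, one_pow,
    Complex.norm_ofNat]
  have h1 := norm_ne_zero_iff.2 hw1
  have h2 := norm_ne_zero_iff.2 hζ1'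
  have h3 := norm_ne_zero_iff.2 hζw
  field_simp
  ring

theorem le_norm_ofReal_sub (t : ℝ) (z : ℂ) : |z.im| ≤ ‖(t : ℂ) - z‖ := by
  simpa using abs_im_le_norm ((t : ℂ) - z)

theorem norm_inv_ofReal_sub_le {z : ℂ} (hz : 0 < z.im) (t : ℝ) :
    ‖((t : ℂ) - z)⁻¹‖ ≤ z.im⁻¹ := by
  rw [norm_inv]
  exact inv_anti₀ hz ((le_abs_self _).trans (le_norm_ofReal_sub t z))

theorem integrable_inv_ofReal_sub (μ : Measure ℝ) [IsFiniteMeasure μ] {z : ℂ} (hz : 0 < z.im) :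
    Integrable (fun t : ℝ ↦ ((t : ℂ) - z)⁻¹) μ :=
  .of_bound (by fun_prop) z.im⁻¹ (.of_forall (norm_inv_ofReal_sub_le hz))

theorem differentiableAt_integral_inv_ofReal_sub (μ : Measure ℝ) [IsFiniteMeasure μ] {z : ℂ}
    (hz : 0 < z.im) : DifferentiableAt ℂ (fun z ↦ ∫ t : ℝ, ((t : ℂ) - z)⁻¹ ∂μ) z := by
  have h : z ∉ algebraMap ℝ ℂ '' μ.support := by
    rintro ⟨t, -, rfl⟩
    simp at hz
  simpa [resolventTransform_def, resolvent, Ring.inverse_eq_inv'] using!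
    (hasDerivAt_resolventTransform z h).differentiableAt

theorem tendsto_integral_inv_ofReal_sub_atTop (μ : Measure ℝ) [IsFiniteMeasure μ] :
    Tendsto (fun s : ℝ ↦ ∫ t : ℝ, ((t : ℂ) - I * s)⁻¹ ∂μ) atTop (𝓝 0) := by
  refine squeeze_zero_norm' (a := fun s ↦ s⁻¹ * μ.real Set.univ) ?_
    (by simpa using tendsto_inv_atTop_zero.mul_const (μ.real Set.univ))
  filter_upwards [eventually_gt_atTop 0] with s hs
  refine norm_integral_le_of_norm_le_const (.of_forall fun t ↦ ?_)
  simpa using norm_inv_ofReal_sub_le (z := I * s) (by simpa using hs) t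

/-- The imaginary part of a Nevanlinna function with `liminf ‖i s f (i s)‖ < ∞` is the Poisson
integral of a finite measure on the line. -/
theorem exists_finiteMeasure_im_eq_im_integral_inv_sub
    (f : ℂ → ℂ)
    (hdiff : ∀ z : ℂ, 0 < z.im → DifferentiableAt ℂ f z)
    (hmap : ∀ z : ℂ, 0 < z.im → 0 ≤ (f z).im)
    (hliminf : liminf (fun s : ℝ =>
        (‖(I * (s : ℂ)) * f (I * (s : ℂ))‖₊ : ENNReal)) atTop < ⊤) :
    ∃ μ : Measure ℝ, IsFiniteMeasure μ ∧
      ∀ z : ℂ, 0 < z.im → (f z).im = (∫ t : ℝ, ((t : ℂ) - z)⁻¹ ∂μ).im := by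
  have hopen : IsOpen {z : ℂ | 0 < z.im} := isOpen_lt continuous_const continuous_im
  have hanal : AnalyticOnNhd ℂ f {z : ℂ | 0 < z.im} :=
    DifferentiableOn.analyticOnNhd (fun z hz ↦ (hdiff z hz).differentiableWithinAt) hopen
  obtain ⟨σ, hσfin, hσ⟩ := exists_finiteMeasure_eq_integral_poissonKernel
    (u := fun w ↦ (f (discToHalfPlane w)).im)
    (fun w hw ↦ by
      have hw' : ‖w‖ < 1 := by simpa using hw
      have hw1 : 1 - w ≠ 0 := fun h ↦ by simp [← sub_eq_zero.1 h] at hw'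
      refine AnalyticAt.harmonicAt_im (f := fun w ↦ f (discToHalfPlane w)) ?_
      refine (hanal _ (im_discToHalfPlane_pos hw')).comp ?_
      unfold discToHalfPlane
      fun_prop (disch := exact hw1))
    (fun w hw ↦ hmap _ (im_discToHalfPlane_pos (by simpa using hw)))
  let ζ : ℝ → ℂ := circleMap 0 1
  have hζ (θ : ℝ) : ‖ζ θ‖ = 1 := by simp [ζ]
  have hζm : Measurable ζ := (continuous_circleMap 0 1).measurable
  let h (θ : ℝ) : ENNReal := 4 * (ENNReal.ofReal (‖1 - ζ θ‖ ^ 2))⁻¹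
  have hhm : Measurable h := by fun_prop
  -- The Fatou lemma along the imaginary axis bounds the total mass
  have hhfin : ∫⁻ θ, h θ ∂σ < ⊤ := by
    let w (s : ℝ) : ℂ := ((s - 1) / (s + 1) : ℝ)
    have hwnorm {s : ℝ} (hs : 0 < s) : ‖w s‖ < 1 := by
      rw [norm_real, Real.norm_eq_abs, abs_lt, lt_div_iff₀ (by linarith),
        div_lt_iff₀ (by linarith)]
      constructor <;> linarith
    have hws {s : ℝ} (hs : 0 < s) : discToHalfPlane (w s) = I * s := by
      have : (s : ℂ) + 1 ≠ 0 := by exact_mod_cast (by linarith : s + 1 ≠ 0)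
      have h1 : 1 - w s = 2 / (s + 1) := by simp only [w]; push_cast; field_simp; ring
      have h2 : 1 + w s = 2 * s / (s + 1) := by simp only [w]; push_cast; field_simp; ring
      rw [discToHalfPlane, h1, h2]
      field_simp
    let q (s : ℝ) (θ : ℝ) : ENNReal := ENNReal.ofReal (4 * (s / (s + 1)) ^ 2) *
      (ENNReal.ofReal (‖ζ θ - w s‖ ^ 2))⁻¹
    have hq {s : ℝ} (hs : 0 < s) (θ : ℝ) :
        q s θ = ENNReal.ofReal (s * poissonKernel 0 (w s) (ζ θ)) := by
      have hne : 0 < ‖ζ θ - w s‖ := norm_pos_iff.2 fun h ↦ by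
        have h1 := hwnorm hs
        rw [← sub_eq_zero.1 h, hζ] at h1
        exact lt_irrefl _ h1
      simp only [q]
      rw [← ENNReal.ofReal_inv_of_pos (by positivity), ← ENNReal.ofReal_mul (by positivity)]
      congr 1
      simp only [poissonKernel, sub_zero, hζ, w, norm_real, Real.norm_eq_abs, sq_abs]
      field_simp
      ring
    have htend (θ : ℝ) : Tendsto (fun s ↦ q s θ) atTop (𝓝 (h θ)) := by
      have hs1 : Tendsto (fun s : ℝ ↦ s / (s + 1)) atTop (𝓝 1) := by
        have h1 : Tendsto (fun s : ℝ ↦ 1 - (s + 1)⁻¹) atTop (𝓝 (1 - 0)) :=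
          (tendsto_inv_atTop_zero.comp (tendsto_atTop_add_const_right _ _ tendsto_id)).const_sub 1
        rw [sub_zero] at h1
        refine h1.congr' ?_
        filter_upwards [eventually_gt_atTop 0] with s hs
        field_simp
        ring
      have hw1 : Tendsto w atTop (𝓝 1) := by
        have h1 : Tendsto (fun s : ℝ ↦ ((2 * (s / (s + 1)) - 1 : ℝ) : ℂ)) atTop
            (𝓝 ((2 * 1 - 1 : ℝ) : ℂ)) :=
          (continuous_ofReal.tendsto _).comp ((hs1.const_mul 2).sub_const 1)
        norm_num at h1
        refine h1.congr' ?_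
        filter_upwards [eventually_gt_atTop 0] with s hs
        have : (s : ℂ) + 1 ≠ 0 := by exact_mod_cast (by linarith : s + 1 ≠ 0)
        simp only [w]
        push_cast
        field_simp
        ring
      have h4 : Tendsto (fun s : ℝ ↦ ENNReal.ofReal (4 * (s / (s + 1)) ^ 2)) atTop (𝓝 4) := by
        simpa using ENNReal.tendsto_ofReal ((hs1.pow 2).const_mul 4)
      have h5 : Tendsto (fun s ↦ (ENNReal.ofReal (‖ζ θ - w s‖ ^ 2))⁻¹) atTop
          (𝓝 (ENNReal.ofReal (‖1 - ζ θ‖ ^ 2))⁻¹) := by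
        rw [norm_sub_rev 1]
        exact (ENNReal.tendsto_ofReal ((hw1.const_sub _).norm.pow 2)).inv
      exact ENNReal.Tendsto.mul h4 (.inl (by norm_num)) h5 (.inr (by norm_num))
    calc ∫⁻ θ, h θ ∂σ = ∫⁻ θ, liminf (fun s ↦ q s θ) atTop ∂σ := by
          simp only [(htend _).liminf_eq]
      _ ≤ liminf (fun s ↦ ∫⁻ θ, q s θ ∂σ) atTop := lintegral_liminf_le fun s ↦ by fun_prop
      _ ≤ liminf (fun s : ℝ ↦ (‖(I * (s : ℂ)) * f (I * (s : ℂ))‖₊ : ENNReal)) atTop := by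
          refine liminf_le_liminf ?_
          filter_upwards [eventually_gt_atTop 0] with s hs
          have hint := hσ (w s) (by simpa using hwnorm hs)
          simp only [hws hs] at hint
          have hi : Integrable (fun θ ↦ poissonKernel 0 (w s) (ζ θ)) σ :=
            .of_bound (continuous_poissonKernel_circleMap (hwnorm hs)).aestronglyMeasurable _
              (.of_forall (norm_poissonKernel_circleMap_le (hwnorm hs)))
          simp only [hq hs]
          rw [← ofReal_integral_eq_lintegral_ofReal (hi.const_mul s)
            (.of_forall fun θ ↦ mul_nonneg hs.le (poissonKernel_circleMap_nonneg (hwnorm hs) θ)),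
            integral_const_mul, ← hint, ← enorm_eq_nnnorm, ← ofReal_norm]
          refine ENNReal.ofReal_le_ofReal ?_
          rw [norm_mul, norm_mul, norm_I, one_mul, norm_real, Real.norm_of_nonneg hs.le]
          gcongr
          exact (le_abs_self _).trans (abs_im_le_norm _)
      _ < ⊤ := hliminf
  have hhae : ∀ᵐ θ ∂σ, h θ < ⊤ := ae_lt_top hhm hhfin.ne
  have hTm : Measurable fun θ ↦ (discToHalfPlane (ζ θ)).re := by
    unfold discToHalfPlane
    fun_prop
  have hfin : IsFiniteMeasure (σ.withDensity h) := isFiniteMeasure_withDensity hhfin.ne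
  refine ⟨(σ.withDensity h).map fun θ ↦ (discToHalfPlane (ζ θ)).re, inferInstance,
    fun z hz ↦ ?_⟩
  obtain ⟨w, hw, rfl⟩ := exists_discToHalfPlane_eq hz
  have him := imCLM.integral_comp_comm (integrable_inv_ofReal_sub
    ((σ.withDensity h).map fun θ ↦ (discToHalfPlane (ζ θ)).re) hz)
  simp only [imCLM_apply] at him
  rw [← him, integral_map hTm.aemeasurable (by fun_prop),
    integral_withDensity_eq_integral_toReal_smul hhm hhae, hσ w (by simpa using hw)]
  refine integral_congr_ae ?_
  filter_upwards [hhae] with θ hθ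
  have hζ1 : ζ θ ≠ 1 := fun h1 ↦ by simp [h, h1] at hθ
  rw [← mul_im_inv_sub_discToHalfPlane hw (hζ θ) hζ1]
  simp [h]

/-- Scalar Nevanlinna representation with finite mass: a function holomorphic on the
upper half plane, mapping it into the closed upper half plane, such that
`liminf_{s → +∞} |i·s·f(i·s)| < ∞`, is the Cauchy transform of a finite Borel
measure on ℝ. -/
theorem nevanlinna_finite_mass
    (f : ℂ → ℂ)
    (hdiff : ∀ z : ℂ, 0 < z.im → DifferentiableAt ℂ f z)
    (hmap : ∀ z : ℂ, 0 < z.im → 0 ≤ (f z).im)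
    (hliminf :
      liminf (fun s : ℝ =>
        (‖(Complex.I * (s : ℂ)) * f (Complex.I * (s : ℂ))‖₊ : ENNReal)) atTop < ⊤) :
    ∃ μ : Measure ℝ, IsFiniteMeasure μ ∧
      ∀ z : ℂ, 0 < z.im → f z = ∫ t : ℝ, ((t : ℂ) - z)⁻¹ ∂μ := by
  obtain ⟨μ, hμ, him⟩ := exists_finiteMeasure_im_eq_im_integral_inv_sub f hdiff hmap hliminf
  refine ⟨μ, hμ, ?_⟩
  have hopen : IsOpen {z : ℂ | 0 < z.im} := isOpen_lt continuous_const continuous_im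
  have hconn : IsConnected {z : ℂ | 0 < z.im} :=
    ⟨⟨I, by simp⟩, (convex_halfSpace_im_gt 0).isPreconnected⟩
  obtain ⟨c, hc⟩ := AnalyticOnNhd.eq_const_of_im_eq_const (c₀ := 0)
    (f := fun z ↦ f z - ∫ t : ℝ, ((t : ℂ) - z)⁻¹ ∂μ)
    (DifferentiableOn.analyticOnNhd (fun z hz ↦ ((hdiff z hz).sub
      (differentiableAt_integral_inv_ofReal_sub μ hz)).differentiableWithinAt) hopen)
    (fun z hz ↦ by simp [him z hz]) hopen hconn
  obtain ⟨C, hC, hCtop⟩ := exists_between hliminf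
  obtain ⟨s, hs, hsC⟩ := exists_seq_forall_of_frequently
    (frequently_lt_of_liminf_lt (by isBoundedDefault) hC)
  have hf0 : Tendsto (fun n ↦ f (I * s n)) atTop (𝓝 0) := by
    refine squeeze_zero_norm' (a := fun n ↦ C.toReal * (s n)⁻¹) ?_
      (by simpa using (tendsto_inv_atTop_zero.comp hs).const_mul C.toReal)
    filter_upwards [hs.eventually_gt_atTop 0] with n hn
    have h1 := ENNReal.toReal_mono hCtop.ne (hsC n).le
    rw [ENNReal.coe_toReal, coe_nnnorm, norm_mul, norm_mul, norm_I, one_mul, norm_real,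
      Real.norm_of_nonneg hn.le] at h1
    rw [← div_eq_mul_inv, le_div_iff₀ hn]
    linarith
  have hc0 : c = 0 := by
    refine tendsto_nhds_unique (tendsto_const_nhds.congr' ?_)
      (by simpa using hf0.sub ((tendsto_integral_inv_ofReal_sub_atTop μ).comp hs))
    filter_upwards [hs.eventually_gt_atTop 0] with n hn
    exact (hc (I * s n) (show 0 < (I * s n).im by simpa using hn)).symm
  intro z hz
  rw [← sub_eq_zero, ← hc0]
  exact hc z hz
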